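/- Let k ≥ 1, let w ∈ F_n^k be a unitary, and let λ_w : A → A be a unital *-homomorphism with λ_w(Sᵢ) = wSᵢ for all i. Let D¹ denote the linear span of {SᵢSᵢ* : i = 1,…,n} and let D denote the closed linear span of {S_μS_μ* : μ a finite multi-index over {1,…,n}} (the diagonal). If w D¹ w* = φ^{k-1}(D¹), then λ_w(D) ⊆ D. -/

import Mathlib

noncomputable section CuntzSetup

/-- The word `S_μ = S_{μ₁} ⋯ S_{μ_k}` associated to a multi-index `μ ∈ {1,…,n}^k`. -/
def cuntzWord {A : Type*} [Monoid A] {n k : ℕ} (S : Fin n → A) (μ : Fin k → Fin n) : A :=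
  (List.ofFn fun i => S (μ i)).prod

/-- The canonical shift `φ(x) = ∑ᵢ Sᵢ x Sᵢ*`. -/
def cuntzPhi {A : Type*} [Ring A] [StarRing A] {n : ℕ} (S : Fin n → A) (x : A) : A :=
  ∑ i, S i * x * star (S i)

/-- `u_k = u φ(u) φ²(u) ⋯ φ^{k-1}(u)`. -/
def cuntzUk {A : Type*} [Ring A] [StarRing A] {n : ℕ} (S : Fin n → A) (u : A) (k : ℕ) : A :=
  ((List.range k).map fun j => (cuntzPhi S)^[j] u).prod

/-- `F_n^k`, the linear span of `{S_μ S_ν* : |μ| = |ν| = k}`. -/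
def cuntzF {A : Type*} [Ring A] [StarRing A] [Algebra ℂ A] {n : ℕ} (S : Fin n → A) (k : ℕ) :
    Submodule ℂ A :=
  Submodule.span ℂ {x | ∃ μ ν : Fin k → Fin n, x = cuntzWord S μ * star (cuntzWord S ν)}

end CuntzSetup

/-- Isometries whose range projections sum to `1` have pairwise orthogonal ranges. -/
theorem star_mul_eq_ite_of_sum_mul_star_eq_one {A : Type*} [CStarAlgebra A] {n : ℕ}
    {S : Fin n → A} (hiso : ∀ i, star (S i) * S i = 1)
    (hcuntz : ∑ i, S i * star (S i) = 1) (i j : Fin n) :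
    star (S i) * S j = if i = j then 1 else 0 := by
  let _ : PartialOrder A := CStarAlgebra.spectralOrder A
  have _ : StarOrderedRing A := CStarAlgebra.spectralOrderedRing A
  split_ifs with hij
  · rw [hij, hiso]
  · have hsum : ∑ l, star (S i) * (S l * star (S l)) * S i = 1 := by
      rw [← Finset.sum_mul, ← Finset.mul_sum, hcuntz, mul_one, hiso]
    have hself : star (S i) * (S i * star (S i)) * S i = 1 := by
      rw [← mul_assoc, hiso, one_mul, hiso]
    rw [← Finset.add_sum_erase _ _ (Finset.mem_univ i), hself, add_eq_left,
      Finset.sum_eq_zero_iff_of_nonneg] at hsum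
    · have h := hsum j (by simp [Ne.symm hij])
      rw [← CStarRing.mul_star_self_eq_zero_iff, star_mul, star_star, ← h]
      simp only [mul_assoc]
    · intro l _
      have h := mul_star_self_nonneg (star (S i) * S l)
      simpa only [star_mul, star_star, mul_assoc] using h

section CuntzAlgebra

variable {A : Type*} {n : ℕ}

theorem cuntzWord_zero [Monoid A] (S : Fin n → A) (μ : Fin 0 → Fin n) : cuntzWord S μ = 1 := by
  simp [cuntzWord]

theorem cuntzWord_succ [Monoid A] {m : ℕ} (S : Fin n → A) (μ : Fin (m + 1) → Fin n) :
    cuntzWord S μ = S (μ 0) * cuntzWord S (fun i => μ i.succ) := by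
  simp [cuntzWord, List.ofFn_succ]

section Shift

variable [Ring A] [StarRing A] {S : Fin n → A}

theorem cuntzPhi_mul_generator (hS : ∀ i j, star (S i) * S j = if i = j then 1 else 0)
    (x : A) (i : Fin n) : cuntzPhi S x * S i = S i * x := by
  simp [cuntzPhi, Finset.sum_mul, mul_assoc, hS]

theorem star_generator_mul_cuntzPhi (hS : ∀ i j, star (S i) * S j = if i = j then 1 else 0)
    (x : A) (i : Fin n) : star (S i) * cuntzPhi S x = x * star (S i) := by
  simp [cuntzPhi, Finset.mul_sum, ← mul_assoc, hS]

theorem cuntzPhi_mul (hS : ∀ i j, star (S i) * S j = if i = j then 1 else 0) (x y : A) :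
    cuntzPhi S (x * y) = cuntzPhi S x * cuntzPhi S y := by
  conv_rhs => rw [cuntzPhi.eq_def S y]
  simp_rw [Finset.mul_sum, ← mul_assoc, cuntzPhi_mul_generator hS, cuntzPhi, mul_assoc]

theorem iterate_cuntzPhi_mul (hS : ∀ i j, star (S i) * S j = if i = j then 1 else 0) (m : ℕ)
    (x y : A) : (cuntzPhi S)^[m] (x * y) = (cuntzPhi S)^[m] x * (cuntzPhi S)^[m] y := by
  induction m generalizing x y with
  | zero => rfl
  | succ m ih => simp only [Function.iterate_succ_apply, cuntzPhi_mul hS, ih]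

theorem iterate_cuntzPhi_one (hcuntz : ∑ i, S i * star (S i) = 1) (m : ℕ) :
    (cuntzPhi S)^[m] 1 = 1 :=
  Function.iterate_fixed (by simp [cuntzPhi, hcuntz]) m

theorem iterate_cuntzPhi_mul_cuntzWord
    (hS : ∀ i j, star (S i) * S j = if i = j then 1 else 0) {m : ℕ} (μ : Fin m → Fin n) (x : A) :
    (cuntzPhi S)^[m] x * cuntzWord S μ = cuntzWord S μ * x := by
  induction m with
  | zero => simp [cuntzWord_zero]
  | succ m ih =>
    rw [cuntzWord_succ, Function.iterate_succ_apply', ← mul_assoc, cuntzPhi_mul_generator hS,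
      mul_assoc, ih, mul_assoc]

theorem star_cuntzWord_mul_iterate_cuntzPhi
    (hS : ∀ i j, star (S i) * S j = if i = j then 1 else 0) {m : ℕ} (μ : Fin m → Fin n) (x : A) :
    star (cuntzWord S μ) * (cuntzPhi S)^[m] x = x * star (cuntzWord S μ) := by
  induction m with
  | zero => simp [cuntzWord_zero]
  | succ m ih =>
    rw [cuntzWord_succ, Function.iterate_succ_apply', star_mul, mul_assoc,
      star_generator_mul_cuntzPhi hS, ← mul_assoc, ih, mul_assoc]

theorem commute_iterate_cuntzPhi_of_mem_cuntzF [Algebra ℂ A]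
    (hS : ∀ i j, star (S i) * S j = if i = j then 1 else 0) {k : ℕ} {w : A}
    (hw : w ∈ cuntzF S k) (x : A) : Commute ((cuntzPhi S)^[k] x) w := by
  induction hw using Submodule.span_induction with
  | mem y hy =>
    obtain ⟨μ, ν, rfl⟩ := hy
    rw [commute_iff_eq, ← mul_assoc, iterate_cuntzPhi_mul_cuntzWord hS, mul_assoc, mul_assoc,
      star_cuntzWord_mul_iterate_cuntzPhi hS]
  | zero => exact Commute.zero_right _
  | add y z _ _ hy hz => exact hy.add_right hz
  | smul c y _ hy => exact hy.smul_right c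

end Shift

section Diagonal

variable [Ring A] [StarRing A] [Algebra ℂ A]

/-- The linear span of the diagonal projections `S_μ S_μ*`. -/
abbrev cuntzDiagonal (S : Fin n → A) : Submodule ℂ A :=
  Submodule.span ℂ
    {y : A | ∃ (m : ℕ) (μ : Fin m → Fin n), y = cuntzWord S μ * star (cuntzWord S μ)}

variable {S : Fin n → A}

theorem one_mem_cuntzDiagonal : (1 : A) ∈ cuntzDiagonal S :=
  Submodule.subset_span ⟨0, Fin.elim0, by simp [cuntzWord_zero]⟩

theorem conj_generator_mem_cuntzDiagonal (i : Fin n) {d : A} (hd : d ∈ cuntzDiagonal S) :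
    S i * d * star (S i) ∈ cuntzDiagonal S := by
  induction hd using Submodule.span_induction with
  | mem y hy =>
    obtain ⟨m, μ, rfl⟩ := hy
    refine Submodule.subset_span ⟨m + 1, Fin.cons i μ, ?_⟩
    simp [cuntzWord_succ, mul_assoc]
  | zero => simp
  | add y z _ _ hy hz => rw [mul_add, add_mul]; exact add_mem hy hz
  | smul c y _ hy =>
    rw [mul_smul_comm, smul_mul_assoc]; exact Submodule.smul_mem _ c hy

theorem cuntzPhi_mem_cuntzDiagonal {d : A} (hd : d ∈ cuntzDiagonal S) :
    cuntzPhi S d ∈ cuntzDiagonal S :=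
  Submodule.sum_mem _ fun i _ => conj_generator_mem_cuntzDiagonal i hd

theorem iterate_cuntzPhi_mem_cuntzDiagonal (m : ℕ) {d : A} (hd : d ∈ cuntzDiagonal S) :
    (cuntzPhi S)^[m] d ∈ cuntzDiagonal S := by
  induction m with
  | zero => exact hd
  | succ m ih => rw [Function.iterate_succ_apply']; exact cuntzPhi_mem_cuntzDiagonal ih

theorem mul_cuntzPhi_mem_cuntzDiagonal
    (hS : ∀ i j, star (S i) * S j = if i = j then 1 else 0) {q d : A}
    (hq : q ∈ Submodule.span ℂ (Set.range fun i => S i * star (S i)))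
    (hd : d ∈ cuntzDiagonal S) : q * cuntzPhi S d ∈ cuntzDiagonal S := by
  induction hq using Submodule.span_induction with
  | mem y hy =>
    obtain ⟨i, rfl⟩ := hy
    simp only [mul_assoc, star_generator_mul_cuntzPhi hS]
    rw [← mul_assoc]
    exact conj_generator_mem_cuntzDiagonal i hd
  | zero => simp
  | add y z _ _ hy hz => rw [add_mul]; exact add_mem hy hz
  | smul c y _ hy => rw [smul_mul_assoc]; exact Submodule.smul_mem _ c hy

/-- `λ_w(S_μ S_μ*)` is the `(k-1)`-st shift of a diagonal element. -/
theorem exists_map_cuntzWord_eq_iterate_cuntzPhi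
    (hS : ∀ i j, star (S i) * S j = if i = j then 1 else 0)
    (hcuntz : ∑ i, S i * star (S i) = 1) {k : ℕ} (hk : 1 ≤ k) {w : A} (hwF : w ∈ cuntzF S k)
    (hw : w ∈ unitary A) (lw : A →⋆ₐ[ℂ] A) (hlw : ∀ i, lw (S i) = w * S i)
    (hD : ∀ i, ∃ q ∈ Submodule.span ℂ (Set.range fun i => S i * star (S i)),
      (cuntzPhi S)^[k - 1] q = w * (S i * star (S i)) * star w)
    {m : ℕ} (μ : Fin m → Fin n) :
    ∃ d ∈ cuntzDiagonal S,
      lw (cuntzWord S μ * star (cuntzWord S μ)) = (cuntzPhi S)^[k - 1] d := by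
  induction m with
  | zero =>
    exact ⟨1, one_mem_cuntzDiagonal, by simp [cuntzWord_zero, iterate_cuntzPhi_one hcuntz]⟩
  | succ m ih =>
    obtain ⟨d, hd, hμ⟩ := ih fun i => μ i.succ
    obtain ⟨q, hq, hqi⟩ := hD (μ 0)
    refine ⟨q * cuntzPhi S d, mul_cuntzPhi_mem_cuntzDiagonal hS hq hd, ?_⟩
    have hcomm := commute_iterate_cuntzPhi_of_mem_cuntzF hS hwF d
    obtain ⟨k, rfl⟩ := Nat.exists_eq_add_of_le' hk
    rw [Nat.add_sub_cancel] at hqi hμ ⊢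
    have hgen := star_generator_mul_cuntzPhi hS ((cuntzPhi S)^[k] d) (μ 0)
    rw [← Function.iterate_succ_apply' (cuntzPhi S)] at hgen
    calc lw (cuntzWord S μ * star (cuntzWord S μ))
        = w * S (μ 0) * lw (cuntzWord S (fun i => μ i.succ) *
            star (cuntzWord S fun i => μ i.succ)) * (star (S (μ 0)) * star w) := by
          simp only [cuntzWord_succ S μ, star_mul, map_mul, map_star, hlw, mul_assoc]
      _ = w * (S (μ 0) * star (S (μ 0))) * ((cuntzPhi S)^[k + 1] d * (star w * w)) * star w := by
          rw [hμ, Unitary.star_mul_self_of_mem hw, mul_one]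
          simp only [mul_assoc]
          rw [← mul_assoc (star (S (μ 0))) ((cuntzPhi S)^[k + 1] d), hgen, mul_assoc]
      _ = w * (S (μ 0) * star (S (μ 0))) * star w * (cuntzPhi S)^[k + 1] d := by
          have h : (cuntzPhi S)^[k + 1] d * star w = star w * (cuntzPhi S)^[k + 1] d := by
            have := congr_arg (fun x => star w * x * star w) hcomm.eq
            simp only [mul_assoc, Unitary.mul_star_self_of_mem hw, mul_one] at this
            rw [this, ← mul_assoc, Unitary.star_mul_self_of_mem hw, one_mul]
          rw [Unitary.star_mul_self_of_mem hw, mul_one, mul_assoc, h, ← mul_assoc]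
      _ = (cuntzPhi S)^[k] (q * cuntzPhi S d) := by
          rw [iterate_cuntzPhi_mul hS, hqi, ← Function.iterate_succ_apply]

end Diagonal

end CuntzAlgebra

/-- if a unitary `w ∈ F_n^k` satisfies `w D¹ w* = φ^{k-1}(D¹)`,
where `D¹ = span{SᵢSᵢ*}`, then `λ_w` maps the diagonal `D` (the closed linear
span of `{S_μ S_μ*}`) into itself. -/
theorem stmt15 {A : Type*} [NormedRing A] [StarRing A] [CStarRing A]
    [CompleteSpace A] [NormedAlgebra ℂ A] [StarModule ℂ A]
    {n : ℕ} (hn : 2 ≤ n) (S : Fin n → A)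
    (hiso : ∀ i, star (S i) * S i = 1)
    (hcuntz : ∑ i, S i * star (S i) = 1)
    (k : ℕ) (hk : 1 ≤ k)
    (w : A) (hwF : w ∈ cuntzF S k) (hw : w ∈ unitary A)
    (lw : A →⋆ₐ[ℂ] A) (hlw : ∀ i, lw (S i) = w * S i)
    (hD1 : (fun d => w * d * star w) ''
          ((Submodule.span ℂ (Set.range fun i => S i * star (S i)) : Submodule ℂ A) : Set A) =
        (cuntzPhi S)^[k - 1] ''
          ((Submodule.span ℂ (Set.range fun i => S i * star (S i)) : Submodule ℂ A) : Set A)) :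
    ∀ x ∈ closure ((Submodule.span ℂ
        {y : A | ∃ (m : ℕ) (μ : Fin m → Fin n), y = cuntzWord S μ * star (cuntzWord S μ)} :
          Submodule ℂ A) : Set A),
      lw x ∈ closure ((Submodule.span ℂ
        {y : A | ∃ (m : ℕ) (μ : Fin m → Fin n), y = cuntzWord S μ * star (cuntzWord S μ)} :
          Submodule ℂ A) : Set A) := by
  let _ : CStarAlgebra A := { }
  have hS := star_mul_eq_ite_of_sum_mul_star_eq_one hiso hcuntz
  have hD (i : Fin n) : ∃ q ∈ Submodule.span ℂ (Set.range fun i => S i * star (S i)),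
      (cuntzPhi S)^[k - 1] q = w * (S i * star (S i)) * star w :=
    hD1.subset ⟨_, Submodule.subset_span ⟨i, rfl⟩, rfl⟩
  have hmap : cuntzDiagonal S ≤ (cuntzDiagonal S).comap lw.toAlgHom.toLinearMap := by
    refine Submodule.span_le.mpr ?_
    rintro _ ⟨m, μ, rfl⟩
    obtain ⟨d, hd, h⟩ :=
      exists_map_cuntzWord_eq_iterate_cuntzPhi hS hcuntz hk hwF hw lw hlw hD μ
    change lw _ ∈ cuntzDiagonal S
    rw [h]
    exact iterate_cuntzPhi_mem_cuntzDiagonal (k - 1) hd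
  have hcont : Continuous lw :=
    AddMonoidHomClass.continuous_of_bound lw 1 fun a => by
      simpa using NonUnitalStarAlgHom.norm_apply_le lw a
  exact fun x hx => map_mem_closure hcont hx hmap
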